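/- There exists Y > 0 such that for every τ in the upper half-plane ℍ with Im τ > Y, setting s(τ) = −27·η(3τ)¹²/η(τ)¹², one has (3E₂(3τ) − E₂(τ))/2 = ((1−s(τ))/(1+s(τ)))^{2/3} · ₂F₁(1/6, 2/3; 1; 4s(τ)/(1+s(τ))²)², where the power is the principal branch. -/

import Mathlib

open Complex

/-- Gauss hypergeometric series `₂F₁(a,b;c;z)`. -/
noncomputable def hyp2F1 (a b c z : ℂ) : ℂ :=
  ∑' n : ℕ, ((ascPochhammer ℂ n).eval a * (ascPochhammer ℂ n).eval b) /
    ((ascPochhammer ℂ n).eval c * (n.factorial : ℂ)) * z ^ n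

/-- `q = e^{2πiτ}`. -/
noncomputable def qpar (τ : ℂ) : ℂ := Complex.exp (2 * (Real.pi : ℂ) * Complex.I * τ)

/-- Normalized Eisenstein series of weight 2: `E₂(τ) = 1 − 24 ∑_{n≥1} n qⁿ/(1−qⁿ)`. -/
noncomputable def Eis2 (τ : ℂ) : ℂ :=
  1 - 24 * ∑' n : ℕ, ((n : ℂ) + 1) * qpar τ ^ (n + 1) / (1 - qpar τ ^ (n + 1))

/-- Dedekind eta function `η(τ) = q^{1/24} ∏_{n≥1} (1 − qⁿ)`, `q^{1/24} = e^{2πiτ/24}`. -/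
noncomputable def dedekindEta (τ : ℂ) : ℂ :=
  Complex.exp (2 * (Real.pi : ℂ) * Complex.I * τ / 24) * ∏' n : ℕ, (1 - qpar τ ^ (n + 1))

noncomputable section

open scoped UpperHalfPlane
open Filter Topology Function

/-- Euler's product `∏_{n≥1} (1 - qⁿ)`. -/
def eulerProd (q : ℂ) : ℂ := ∏' n : ℕ, (1 - q ^ (n + 1))

lemma differentiableOn_eulerProd : DifferentiableOn ℂ eulerProd (Metric.ball 0 1) :=
  ModularForm.differentiableOn_tprod_one_sub_pow

lemma one_sub_pow_succ_ne_zero {q : ℂ} (hq : ‖q‖ < 1) (n : ℕ) : 1 - q ^ (n + 1) ≠ 0 := by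
  intro h
  have h1 : ‖q ^ (n + 1)‖ < 1 := by
    rw [norm_pow]
    exact pow_lt_one₀ (norm_nonneg q) hq n.succ_ne_zero
  rw [← sub_eq_zero.mp h, norm_one] at h1
  exact lt_irrefl _ h1

lemma eulerProd_ne_zero {q : ℂ} (hq : ‖q‖ < 1) : eulerProd q ≠ 0 := by
  have h := tprod_one_add_ne_zero_of_summable (f := fun n : ℕ ↦ -q ^ (n + 1))
    (fun n ↦ by simpa [sub_eq_add_neg] using one_sub_pow_succ_ne_zero hq n)
    (by
      simpa only [norm_neg, norm_pow] using (summable_nat_add_iff 1).mpr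
        (summable_geometric_of_lt_one (norm_nonneg _) hq))
  simpa only [eulerProd, sub_eq_add_neg] using h

lemma eulerProd_zero : eulerProd 0 = 1 := by simp [eulerProd]

lemma logDeriv_eulerProd {q : ℂ} (hq : ‖q‖ < 1) :
    logDeriv eulerProd q = -∑' n : ℕ, ((n : ℂ) + 1) * q ^ n / (1 - q ^ (n + 1)) := by
  have hterm (n : ℕ) : logDeriv (fun x : ℂ ↦ 1 - x ^ (n + 1)) q =
      -(((n : ℂ) + 1) * q ^ n / (1 - q ^ (n + 1))) := by
    simp [logDeriv_apply, neg_div]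
  have hsum : Summable fun n : ℕ ↦ ((n : ℂ) + 1) * q ^ n / (1 - q ^ (n + 1)) := by
    rcases eq_or_ne q 0 with rfl | h0
    · exact (hasSum_single 0 fun n hn ↦ by simp [hn]).summable
    · have h : Summable fun n : ℕ ↦
          ((n + 1 : ℕ) : ℂ) ^ 1 * q ^ (n + 1) / (1 - q ^ (n + 1)) :=
        (summable_nat_add_iff (f := fun n : ℕ ↦ (n : ℂ) ^ 1 * q ^ n / (1 - q ^ n)) 1).mpr
          (summable_norm_pow_mul_geometric_div_one_sub 1 hq)
      refine (h.mul_left q⁻¹).congr fun n ↦ ?_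
      have h1 := one_sub_pow_succ_ne_zero hq n
      push_cast
      field_simp
      ring
  rw [← tsum_neg, ← tsum_congr hterm]
  exact logDeriv_tprod_eq_tsum (f := fun (n : ℕ) (x : ℂ) ↦ 1 - x ^ (n + 1))
    (s := Metric.ball 0 1) Metric.isOpen_ball (x := q) (mem_ball_zero_iff.mpr hq)
    (one_sub_pow_succ_ne_zero hq) (fun n ↦ by fun_prop) (hsum.neg.congr fun n ↦ (hterm n).symm)
    ModularForm.multipliableLocallyUniformlyOn_one_sub_pow (eulerProd_ne_zero hq)

lemma logDeriv_eulerProd_zero : logDeriv eulerProd 0 = -1 := by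
  rw [logDeriv_eulerProd (by simp), tsum_eq_single 0 fun n hn ↦ by simp [hn]]
  simp

lemma differentiableOn_logDeriv_eulerProd :
    DifferentiableOn ℂ (logDeriv eulerProd) (Metric.ball 0 1) :=
  (differentiableOn_eulerProd.deriv Metric.isOpen_ball).div differentiableOn_eulerProd
    fun q hq ↦ eulerProd_ne_zero (by simpa using hq)

lemma hasDerivAt_eulerProd_zero : HasDerivAt eulerProd (-1) 0 := by
  have h := (differentiableOn_eulerProd.differentiableAt
    (Metric.isOpen_ball.mem_nhds (by simp : (0 : ℂ) ∈ Metric.ball 0 1))).hasDerivAt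
  have h' := logDeriv_eulerProd_zero
  rw [logDeriv_apply, eulerProd_zero, div_one] at h'
  rwa [h'] at h

lemma norm_qpar_lt_one {τ : ℂ} (hτ : 0 < τ.im) : ‖qpar τ‖ < 1 := by
  simpa [qpar] using UpperHalfPlane.norm_exp_two_pi_I_lt_one ⟨τ, hτ⟩

lemma qpar_ne_zero (τ : ℂ) : qpar τ ≠ 0 := exp_ne_zero _

lemma qpar_three_mul (τ : ℂ) : qpar (3 * τ) = qpar τ ^ 3 := by
  rw [qpar, qpar, ← exp_nat_mul]
  congr 1
  push_cast
  ring

lemma qpar_add_one (τ : ℂ) : qpar (τ + 1) = qpar τ := by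
  rw [qpar, qpar, mul_add, mul_one, exp_add, exp_two_pi_mul_I, mul_one]

lemma hasDerivAt_qpar (τ : ℂ) : HasDerivAt qpar (2 * Real.pi * I * qpar τ) τ := by
  have h := ((hasDerivAt_id τ).const_mul (2 * Real.pi * I)).cexp
  rw [mul_one, mul_comm (cexp _)] at h
  exact h

lemma tendsto_qpar : Tendsto qpar (comap im atTop) (𝓝[≠] 0) := by
  have := Periodic.qParam_tendsto (h := 1) one_pos
  refine this.congr fun τ ↦ ?_
  simp [Periodic.qParam, qpar]

/-- The normalized Eisenstein series `E₂` as a function of `q`. -/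
def eisTwoDisc (q : ℂ) : ℂ := 1 + 24 * q * logDeriv eulerProd q

lemma Eis2_eq {τ : ℂ} (hτ : 0 < τ.im) : Eis2 τ = eisTwoDisc (qpar τ) := by
  have h (n : ℕ) : qpar τ * (((n : ℂ) + 1) * qpar τ ^ n / (1 - qpar τ ^ (n + 1))) =
      ((n : ℂ) + 1) * qpar τ ^ (n + 1) / (1 - qpar τ ^ (n + 1)) := by ring
  rw [Eis2, eisTwoDisc, logDeriv_eulerProd (norm_qpar_lt_one hτ), mul_assoc, mul_neg,
    mul_neg, sub_eq_add_neg, ← tsum_congr h, tsum_mul_left]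

/-- `(3 E₂(3τ) - E₂(τ)) / 2`. -/
def cubicP (τ : ℂ) : ℂ := (3 * Eis2 (3 * τ) - Eis2 τ) / 2

/-- The function `cubicP` as a function of `q`. -/
def cubicPDisc (q : ℂ) : ℂ := (3 * eisTwoDisc (q ^ 3) - eisTwoDisc q) / 2

lemma im_three_mul_pos {τ : ℂ} (hτ : 0 < τ.im) : 0 < (3 * τ).im := by
  simpa using hτ

lemma cubicP_eq {τ : ℂ} (hτ : 0 < τ.im) : cubicP τ = cubicPDisc (qpar τ) := by
  rw [cubicP, cubicPDisc, Eis2_eq hτ, Eis2_eq (im_three_mul_pos hτ), qpar_three_mul]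

lemma differentiableOn_eisTwoDisc : DifferentiableOn ℂ eisTwoDisc (Metric.ball 0 1) :=
  ((differentiableOn_id.const_mul 24).mul differentiableOn_logDeriv_eulerProd).const_add 1

lemma mapsTo_pow_three_ball :
    Set.MapsTo (fun q : ℂ ↦ q ^ 3) (Metric.ball 0 1) (Metric.ball 0 1) := by
  intro q hq
  rw [mem_ball_zero_iff] at hq ⊢
  rw [norm_pow]
  exact pow_lt_one₀ (norm_nonneg q) hq (by norm_num)

lemma differentiableOn_cubicPDisc : DifferentiableOn ℂ cubicPDisc (Metric.ball 0 1) :=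
  (((differentiableOn_eisTwoDisc.comp (differentiableOn_pow 3)
    mapsTo_pow_three_ball).const_mul 3).sub differentiableOn_eisTwoDisc).div_const 2

lemma cubicPDisc_zero : cubicPDisc 0 = 1 := by
  norm_num [cubicPDisc, eisTwoDisc]

lemma zero_mem_unitBall : (0 : ℂ) ∈ Metric.ball (0 : ℂ) 1 := by simp

lemma hasDerivAt_eisTwoDisc_zero : HasDerivAt eisTwoDisc (-24) 0 := by
  have h := (differentiableOn_logDeriv_eulerProd.differentiableAt
    (Metric.isOpen_ball.mem_nhds zero_mem_unitBall)).hasDerivAt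
  have := (((hasDerivAt_id (0 : ℂ)).const_mul 24).mul h).const_add 1
  simp only [id, logDeriv_eulerProd_zero, mul_zero, zero_mul, add_zero, mul_one, mul_neg] at this
  exact this

lemma hasDerivAt_comp_pow_three_zero {f : ℂ → ℂ} {f' : ℂ} (hf : HasDerivAt f f' 0) :
    HasDerivAt (fun q ↦ f (q ^ 3)) 0 0 := by
  have h3 : HasDerivAt (fun q : ℂ ↦ q ^ 3) 0 0 := by simpa using hasDerivAt_pow 3 (0 : ℂ)
  have h := HasDerivAt.comp (0 : ℂ) (h₂ := f) (h₂' := f') (by simpa using hf) h3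
  rwa [mul_zero] at h

lemma hasDerivAt_cubicPDisc_zero : HasDerivAt cubicPDisc 12 0 := by
  have h := (((hasDerivAt_comp_pow_three_zero hasDerivAt_eisTwoDisc_zero).const_mul 3).sub
    hasDerivAt_eisTwoDisc_zero).div_const 2
  norm_num at h
  exact h

lemma dedekindEta_eq_eta : dedekindEta = ModularForm.eta := by
  ext τ
  simp [dedekindEta, ModularForm.eta, ModularForm.eta_q, Periodic.qParam, qpar]

lemma dedekindEta_ne_zero {τ : ℂ} (hτ : 0 < τ.im) : dedekindEta τ ≠ 0 :=
  dedekindEta_eq_eta ▸ ModularForm.eta_ne_zero hτ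

lemma differentiableAt_dedekindEta {τ : ℂ} (hτ : 0 < τ.im) :
    DifferentiableAt ℂ dedekindEta τ :=
  dedekindEta_eq_eta ▸ ModularForm.differentiableAt_eta_of_mem_upperHalfPlaneSet hτ

lemma sqrt_sq_eq {z : ℂ} (hz : z ≠ 0) : sqrt z ^ 2 = z := by
  rw [sqrt_eq_exp hz, ← exp_nat_mul]
  push_cast
  rw [mul_div_cancel₀ _ two_ne_zero, exp_log hz]

lemma dedekindEta_neg_one_div_pow_six {τ : ℂ} (hτ : 0 < τ.im) :
    dedekindEta (-1 / τ) ^ 6 = I * τ ^ 3 * dedekindEta τ ^ 6 := by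
  have h0 : τ ≠ 0 := by rintro rfl; simp at hτ
  have h : dedekindEta (-1 / τ) = (sqrt I)⁻¹ * (sqrt τ * dedekindEta τ) := by
    rw [dedekindEta_eq_eta]
    exact ModularForm.eta_comp_eq_csqrt_I_inv hτ
  rw [h, mul_pow, mul_pow, inv_pow, pow_mul (sqrt I) 2 3, pow_mul (sqrt τ) 2 3, sqrt_sq_eq h0,
    sqrt_sq_eq I_ne_zero, I_pow_three, inv_neg, inv_I]
  ring

lemma E2_eq_Eis2 (τ : ℍ) : EisensteinSeries.E2 τ = Eis2 τ := by
  have hq : qpar τ = cexp (2 * Real.pi * I * τ) := rfl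
  rw [EisensteinSeries.E2_eq_tsum_cexp, Eis2, ← tsum_pow_div_one_sub_eq_tsum_sigma
    (UpperHalfPlane.norm_exp_two_pi_I_lt_one τ), hq,
    tsum_pnat_eq_tsum_succ (f := fun n ↦ (n : ℂ) ^ 1 * cexp (2 * Real.pi * I * τ) ^ n /
      (1 - cexp (2 * Real.pi * I * τ) ^ n))]
  simp

lemma Eis2_neg_one_div {τ : ℂ} (hτ : 0 < τ.im) :
    Eis2 (-1 / τ) = τ ^ 2 * Eis2 τ + 6 * τ / (Real.pi * I) := by
  lift τ to ℍ using hτ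
  have h0 := UpperHalfPlane.ne_zero τ
  have hS : Eis2 (-1 / τ) = EisensteinSeries.E2 (ModularGroup.S • τ) := by
    rw [E2_eq_Eis2, UpperHalfPlane.modular_S_smul]
    simp [neg_div]
  have h := congrFun (EisensteinSeries.E2_slash_action ModularGroup.S) τ
  rw [SlashInvariantForm.slash_S_apply] at h
  simp only [Pi.sub_apply, Pi.smul_apply, EisensteinSeries.D2_S, smul_eq_mul, riemannZeta_two,
    ← UpperHalfPlane.modular_S_smul] at h
  rw [hS, ← E2_eq_Eis2]
  have hpi : (Real.pi : ℂ) ≠ 0 := by exact_mod_cast Real.pi_ne_zero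
  field_simp at h ⊢
  linear_combination I * h - 6 * (τ : ℂ) * I_sq

lemma ne_zero_of_im_pos {τ : ℂ} (hτ : 0 < τ.im) : τ ≠ 0 := by
  rintro rfl
  simp at hτ

lemma cubicP_add_one {τ : ℂ} (hτ : 0 < τ.im) : cubicP (τ + 1) = cubicP τ := by
  rw [cubicP_eq hτ, cubicP_eq (by simpa using hτ), qpar_add_one]

lemma fricke_eq (τ : ℂ) : -1 / (3 * τ) = (-1 / τ) / 3 := by
  rw [div_div, mul_comm]

lemma three_mul_fricke (τ : ℂ) : 3 * (-1 / (3 * τ)) = -1 / τ := by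
  rw [fricke_eq]
  ring

lemma im_neg_one_div_pos {τ : ℂ} (hτ : 0 < τ.im) : 0 < (-1 / τ).im := by
  simpa [neg_div] using UpperHalfPlane.im_inv_neg_coe_pos ⟨τ, hτ⟩

lemma im_fricke_pos {τ : ℂ} (hτ : 0 < τ.im) : 0 < (-1 / (3 * τ)).im :=
  im_neg_one_div_pos (im_three_mul_pos hτ)

lemma cubicP_fricke {τ : ℂ} (hτ : 0 < τ.im) :
    cubicP (-1 / (3 * τ)) = -3 * τ ^ 2 * cubicP τ := by
  rw [cubicP, cubicP, three_mul_fricke, Eis2_neg_one_div hτ,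
    Eis2_neg_one_div (im_three_mul_pos hτ)]
  ring

/-- `(η(τ) η(3τ))⁶`, a cusp form of weight `6` and level `3`. -/
def etaProd (τ : ℂ) : ℂ := (dedekindEta τ * dedekindEta (3 * τ)) ^ 6

/-- `(η(τ) / η(3τ))¹²`, a modular function of level `3`. -/
def etaQuot (τ : ℂ) : ℂ := (dedekindEta τ / dedekindEta (3 * τ)) ^ 12

/-- `etaProd` divided by `q`, as a function of `q`. -/
def etaProdDisc (q : ℂ) : ℂ := (eulerProd q * eulerProd (q ^ 3)) ^ 6

/-- `q` times `etaQuot`, as a function of `q`. -/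
def etaQuotDisc (q : ℂ) : ℂ := (eulerProd q / eulerProd (q ^ 3)) ^ 12

lemma etaProd_eq (τ : ℂ) : etaProd τ = qpar τ * etaProdDisc (qpar τ) := by
  have hη (z : ℂ) : dedekindEta z = cexp (2 * Real.pi * I * z / 24) * eulerProd (qpar z) := rfl
  have hq : qpar τ = (cexp (2 * Real.pi * I * τ / 24) *
      cexp (2 * Real.pi * I * (3 * τ) / 24)) ^ 6 := by
    rw [← exp_add, ← exp_nat_mul, qpar]
    congr 1
    push_cast
    ring
  rw [etaProd, etaProdDisc, hη, hη, qpar_three_mul]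
  conv_rhs => rw [hq, ← hq]
  rw [mul_mul_mul_comm, mul_pow, ← hq]

lemma etaQuot_eq (τ : ℂ) : etaQuot τ = etaQuotDisc (qpar τ) / qpar τ := by
  have hη (z : ℂ) : dedekindEta z = cexp (2 * Real.pi * I * z / 24) * eulerProd (qpar z) := rfl
  have hq : (qpar τ)⁻¹ = (cexp (2 * Real.pi * I * τ / 24) /
      cexp (2 * Real.pi * I * (3 * τ) / 24)) ^ 12 := by
    rw [← exp_sub, ← exp_nat_mul, qpar, ← exp_neg]
    congr 1
    push_cast
    ring
  rw [etaQuot, etaQuotDisc, hη, hη, qpar_three_mul, mul_div_mul_comm, mul_pow, ← hq]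
  ring

lemma etaProd_add_one (τ : ℂ) : etaProd (τ + 1) = etaProd τ := by
  rw [etaProd_eq, etaProd_eq, qpar_add_one]

lemma etaQuot_add_one (τ : ℂ) : etaQuot (τ + 1) = etaQuot τ := by
  rw [etaQuot_eq, etaQuot_eq, qpar_add_one]

lemma etaProd_ne_zero {τ : ℂ} (hτ : 0 < τ.im) : etaProd τ ≠ 0 :=
  pow_ne_zero _ (mul_ne_zero (dedekindEta_ne_zero hτ) (dedekindEta_ne_zero (im_three_mul_pos hτ)))

lemma etaQuot_ne_zero {τ : ℂ} (hτ : 0 < τ.im) : etaQuot τ ≠ 0 :=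
  pow_ne_zero _ (div_ne_zero (dedekindEta_ne_zero hτ) (dedekindEta_ne_zero (im_three_mul_pos hτ)))

lemma etaProd_fricke {τ : ℂ} (hτ : 0 < τ.im) :
    etaProd (-1 / (3 * τ)) = -27 * τ ^ 6 * etaProd τ := by
  rw [etaProd, etaProd, three_mul_fricke, mul_pow, mul_pow, dedekindEta_neg_one_div_pow_six hτ,
    dedekindEta_neg_one_div_pow_six (im_three_mul_pos hτ)]
  linear_combination 27 * τ ^ 6 * dedekindEta τ ^ 6 * dedekindEta (3 * τ) ^ 6 * I_sq

lemma etaQuot_fricke {τ : ℂ} (hτ : 0 < τ.im) :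
    etaQuot (-1 / (3 * τ)) = 729 / etaQuot τ := by
  have h0 := ne_zero_of_im_pos hτ
  have h1 := dedekindEta_ne_zero hτ
  have h3 := dedekindEta_ne_zero (im_three_mul_pos hτ)
  rw [etaQuot, etaQuot, three_mul_fricke, div_pow, pow_mul _ 6 2, pow_mul _ 6 2,
    dedekindEta_neg_one_div_pow_six hτ, dedekindEta_neg_one_div_pow_six (im_three_mul_pos hτ)]
  field_simp
  ring

lemma differentiableOn_comp_pow_three {f : ℂ → ℂ} (hf : DifferentiableOn ℂ f (Metric.ball 0 1)) :
    DifferentiableOn ℂ (fun q ↦ f (q ^ 3)) (Metric.ball 0 1) :=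
  hf.comp (differentiableOn_pow 3) mapsTo_pow_three_ball

lemma differentiableOn_etaProdDisc : DifferentiableOn ℂ etaProdDisc (Metric.ball 0 1) :=
  (differentiableOn_eulerProd.mul (differentiableOn_comp_pow_three differentiableOn_eulerProd)).pow 6

lemma eulerProd_pow_three_ne_zero {q : ℂ} (hq : ‖q‖ < 1) : eulerProd (q ^ 3) ≠ 0 :=
  eulerProd_ne_zero (by simpa using mapsTo_pow_three_ball (by simpa using hq))

lemma etaProdDisc_ne_zero {q : ℂ} (hq : ‖q‖ < 1) : etaProdDisc q ≠ 0 :=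
  pow_ne_zero _ (mul_ne_zero (eulerProd_ne_zero hq) (eulerProd_pow_three_ne_zero hq))

lemma etaQuotDisc_ne_zero {q : ℂ} (hq : ‖q‖ < 1) : etaQuotDisc q ≠ 0 :=
  pow_ne_zero _ (div_ne_zero (eulerProd_ne_zero hq) (eulerProd_pow_three_ne_zero hq))

lemma differentiableOn_etaQuotDisc : DifferentiableOn ℂ etaQuotDisc (Metric.ball 0 1) :=
  (differentiableOn_eulerProd.div (differentiableOn_comp_pow_three differentiableOn_eulerProd)
    fun _ hq ↦ eulerProd_pow_three_ne_zero (by simpa using hq)).pow 12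

lemma etaProdDisc_zero : etaProdDisc 0 = 1 := by simp [etaProdDisc, eulerProd_zero]

lemma etaQuotDisc_zero : etaQuotDisc 0 = 1 := by simp [etaQuotDisc, eulerProd_zero]

lemma hasDerivAt_etaProdDisc_zero : HasDerivAt etaProdDisc (-6) 0 := by
  have h := (hasDerivAt_eulerProd_zero.mul
    (hasDerivAt_comp_pow_three_zero hasDerivAt_eulerProd_zero)).pow 6
  simp only [eulerProd_zero, ne_eq, OfNat.ofNat_ne_zero, not_false_eq_true, zero_pow, mul_one,
    mul_zero, add_zero] at h
  norm_num [eulerProd_zero] at h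
  exact h

lemma hasDerivAt_etaQuotDisc_zero : HasDerivAt etaQuotDisc (-12) 0 := by
  have h := (hasDerivAt_eulerProd_zero.div
    (hasDerivAt_comp_pow_three_zero hasDerivAt_eulerProd_zero)
    (eulerProd_pow_three_ne_zero (by simp))).pow 12
  norm_num [eulerProd_zero] at h
  exact h

open scoped MatrixGroups ModularForm in
/-- A function on the upper half-plane that is invariant under the modular group and vanishes at
infinity is zero. -/
lemma eq_zero_of_modular_invariant {N : ℂ → ℂ} (hd : DifferentiableOn ℂ N {z | 0 < z.im})
    (hT : ∀ τ, 0 < τ.im → N (τ + 1) = N τ) (hS : ∀ τ, 0 < τ.im → N (-1 / τ) = N τ)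
    (h0 : Tendsto N (comap im atTop) (𝓝 0)) {τ : ℂ} (hτ : 0 < τ.im) : N τ = 0 := by
  set f : ℍ → ℂ := fun z ↦ N z
  have hfS : f ∣[(0 : ℤ)] ModularGroup.S = f := by
    ext z
    rw [ModularForm.SL_slash_apply, UpperHalfPlane.modular_S_smul]
    simpa [f, neg_div] using hS z z.2
  have hfT : f ∣[(0 : ℤ)] ModularGroup.T = f := by
    ext z
    rw [ModularForm.SL_slash_apply, UpperHalfPlane.modular_T_smul]
    simpa [f, add_comm] using hT z z.2
  have hlim : Tendsto f UpperHalfPlane.atImInfty (𝓝 0) :=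
    h0.comp (tendsto_comap_iff.2 tendsto_comap)
  have hinv := SlashInvariantForm.slash_action_generators_SL2Z hfS hfT
  let G : ModularForm 𝒮ℒ 0 :=
    { toFun := f
      slash_action_eq' := by
        rintro A ⟨A, rfl⟩
        exact hinv A
      holo' := by
        rw [UpperHalfPlane.mdifferentiable_iff]
        refine hd.congr fun z hz ↦ ?_
        simp [f, UpperHalfPlane.ofComplex_apply_of_im_pos hz]
      bdd_at_cusps' := fun hc ↦ by
        rw [Subgroup.IsArithmetic.isCusp_iff_isCusp_SL2Z] at hc
        rw [OnePoint.isBoundedAt_iff_forall_SL2Z hc]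
        intro γ _
        rw [hinv]
        exact UpperHalfPlane.IsZeroAtImInfty.isBoundedAtImInfty hlim }
  obtain ⟨c, hc⟩ := ModularFormClass.levelOne_weight_zero_const G
  have hc' : f = Function.const _ c := hc
  have : c = 0 := tendsto_nhds_unique (tendsto_const_nhds.congr fun z ↦ (congrFun hc' z).symm) hlim
  exact (congrFun hc' ⟨τ, hτ⟩).trans this

lemma isPreconnected_upperHalfPlane : IsPreconnected {z : ℂ | 0 < z.im} :=
  (convex_halfSpace_im_gt 0).isPreconnected

lemma tendsto_comap_im_div_three (c : ℝ) :
    Tendsto (fun τ : ℂ ↦ (τ + c) / 3) (comap im atTop) (comap im atTop) := by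
  refine tendsto_comap_iff.2 ?_
  have : im ∘ (fun τ : ℂ ↦ (τ + c) / 3) = fun τ ↦ τ.im / 3 := by
    ext τ; simp [show (3 : ℂ) = (3 : ℝ) by norm_num, div_ofReal_im, -ofReal_ofNat]
  rw [this]
  exact tendsto_comap.atTop_div_const (by norm_num)

lemma im_add_div_three (τ : ℂ) (c : ℝ) : ((τ + c) / 3).im = τ.im / 3 := by
  simp [show (3 : ℂ) = (3 : ℝ) by norm_num, div_ofReal_im, -ofReal_ofNat]

/-- A function on the upper half-plane that is invariant under translation and under the Fricke
involution of level three, and vanishes at infinity, is zero. -/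
lemma eq_zero_of_fricke_invariant {F : ℂ → ℂ} (hd : DifferentiableOn ℂ F {z | 0 < z.im})
    (hT : ∀ τ, 0 < τ.im → F (τ + 1) = F τ) (hW : ∀ τ, 0 < τ.im → F (-1 / (3 * τ)) = F τ)
    (h0 : Tendsto F (comap im atTop) (𝓝 0)) {τ : ℂ} (hτ : 0 < τ.im) : F τ = 0 := by
  have him (c : ℝ) (z : ℂ) (hz : 0 < z.im) : 0 < ((z + c) / 3).im := by
    rw [im_add_div_three]; positivity
  have hdiff (c : ℝ) : DifferentiableOn ℂ (fun z ↦ F ((z + c) / 3)) {z | 0 < z.im} :=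
    hd.comp (by fun_prop) fun z hz ↦ him c z hz
  have hlim (c : ℝ) : Tendsto (fun z ↦ F ((z + c) / 3)) (comap im atTop) (𝓝 0) :=
    h0.comp (tendsto_comap_im_div_three c)
  set G : ℂ → ℂ := fun z ↦ F ((z + (0 : ℝ)) / 3) * F ((z + (1 : ℝ)) / 3) * F ((z + (2 : ℝ)) / 3)
  have hG : DifferentiableOn ℂ G {z | 0 < z.im} := ((hdiff 0).mul (hdiff 1)).mul (hdiff 2)
  have hFG (z : ℂ) (hz : 0 < z.im) : F z * G z = 0 := by
    refine eq_zero_of_modular_invariant (N := fun z ↦ F z * G z) (hd.mul hG) ?_ ?_ ?_ hz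
    · intro z hz
      have h3 := hT _ (him 0 z hz)
      rw [show (z + (0 : ℝ)) / 3 + 1 = (z + 1 + (2 : ℝ)) / 3 by push_cast; ring] at h3
      simp only [G, h3, hT z hz]
      rw [show z + 1 + (0 : ℝ) = z + (1 : ℝ) by push_cast; ring,
        show z + 1 + (1 : ℝ) = z + (2 : ℝ) by push_cast; ring]
      ring
    · intro z hz
      have hz0 := ne_zero_of_im_pos hz
      have hzi := im_neg_one_div_pos hz
      have hne (n : ℝ) : z + n ≠ 0 := ne_zero_of_im_pos (by simpa using hz)
      have e0 : F (-1 / z) = F ((z + (0 : ℝ)) / 3) := by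
        rw [← hW _ (him 0 z hz), ofReal_zero, add_zero, mul_div_cancel₀ _ three_ne_zero]
      have e1 : F ((-1 / z + (0 : ℝ)) / 3) = F z := by
        rw [← hW z hz, ofReal_zero, add_zero, fricke_eq]
      have e2 : F ((-1 / z + (1 : ℝ)) / 3) = F ((z + (2 : ℝ)) / 3) := by
        have h1 := hT _ (him (-1) z hz)
        have h2 := hW _ (him (-1) z hz)
        have h3 := hW _ (him 1 _ hzi)
        have h4 := hT _ (im_fricke_pos (him 1 _ hzi))
        have hn := hne (-1)
        push_cast at *
        rw [show (z + -1) / 3 + 1 = (z + 2) / 3 by ring] at h1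
        rw [h1, ← h2, ← h3, ← h4]
        congr 1
        have : -1 + z ≠ 0 := by rwa [add_comm]
        have h5 : -1 / z + 1 ≠ 0 := by
          rw [show -1 / z + 1 = (-1 + z) / z by field_simp]
          exact div_ne_zero this hz0
        field_simp
        ring
      have e3 : F ((-1 / z + (2 : ℝ)) / 3) = F ((z + (1 : ℝ)) / 3) := by
        have h1 := hT _ (him (-1) _ hzi)
        have h2 := hW _ (him (-1) _ hzi)
        have h3 := hW _ (him 1 z hz)
        have h4 := hT _ (im_fricke_pos (him 1 z hz))
        have hn := hne 1
        push_cast at *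
        rw [show (-1 / z + -1) / 3 + 1 = (-1 / z + 2) / 3 by ring] at h1
        rw [h1, ← h2, ← h3, ← h4]
        congr 1
        rw [show -1 / z + -1 = -(z + 1) / z by field_simp; ring]
        field_simp
        ring
      simp only [G, e0, e1, e2, e3]
      ring
    · simpa [G] using h0.mul (((hlim 0).mul (hlim 1)).mul (hlim 2))
  have hopen : IsOpen {z : ℂ | 0 < z.im} := isOpen_lt continuous_const continuous_im
  have key {f g : ℂ → ℂ} (hf : DifferentiableOn ℂ f {z | 0 < z.im})
      (hg : DifferentiableOn ℂ g {z | 0 < z.im}) (hfg : ∀ z : ℂ, 0 < z.im → f z * g z = 0) :=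
    (hf.analyticOnNhd hopen).eq_zero_or_eq_zero_of_mul_eq_zero (hg.analyticOnNhd hopen) hfg
      isPreconnected_upperHalfPlane
  have hback (c : ℝ) (h : ∀ z ∈ {z : ℂ | 0 < z.im}, F ((z + c) / 3) = 0) : F τ = 0 := by
    have := h (3 * τ - c) (by simpa using hτ)
    rwa [sub_add_cancel, mul_div_cancel_left₀ _ (by norm_num)] at this
  rcases key hd hG hFG with h | h
  · exact h τ hτ
  rcases key ((hdiff 0).mul (hdiff 1)) (hdiff 2) h with h | h
  · rcases key (hdiff 0) (hdiff 1) h with h | h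
    exacts [hback 0 h, hback 1 h]
  · exact hback 2 h

lemma isOpen_upperHalfPlane : IsOpen {z : ℂ | 0 < z.im} :=
  isOpen_lt continuous_const continuous_im

lemma mapsTo_qpar : Set.MapsTo qpar {z | 0 < z.im} (Metric.ball 0 1) := fun z hz ↦ by
  simpa using norm_qpar_lt_one hz

lemma differentiableOn_comp_qpar {f : ℂ → ℂ} (hf : DifferentiableOn ℂ f (Metric.ball 0 1)) :
    DifferentiableOn ℂ (fun τ ↦ f (qpar τ)) {z | 0 < z.im} :=
  hf.comp (fun τ _ ↦ (hasDerivAt_qpar τ).differentiableAt.differentiableWithinAt) mapsTo_qpar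

lemma differentiableOn_cubicP : DifferentiableOn ℂ cubicP {z | 0 < z.im} :=
  (differentiableOn_comp_qpar differentiableOn_cubicPDisc).congr fun _ hz ↦ cubicP_eq hz

lemma differentiableOn_qpar {s : Set ℂ} : DifferentiableOn ℂ qpar s :=
  fun τ _ ↦ (hasDerivAt_qpar τ).differentiableAt.differentiableWithinAt

lemma differentiableOn_etaProd : DifferentiableOn ℂ etaProd {z | 0 < z.im} :=
  (differentiableOn_qpar.mul (differentiableOn_comp_qpar differentiableOn_etaProdDisc)).congr
    fun τ _ ↦ etaProd_eq τ

lemma differentiableOn_etaQuot : DifferentiableOn ℂ etaQuot {z | 0 < z.im} :=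
  ((differentiableOn_comp_qpar differentiableOn_etaQuotDisc).div differentiableOn_qpar
    fun τ _ ↦ qpar_ne_zero τ).congr fun τ _ ↦ etaQuot_eq τ

/-- A function of `q` divided by `q` tends to its derivative at the cusp. -/
lemma tendsto_comp_qpar_div {b : ℂ → ℂ} {l : ℂ} (hb : HasDerivAt b l 0) (hb0 : b 0 = 0) :
    Tendsto (fun τ ↦ b (qpar τ) / qpar τ) (comap im atTop) (𝓝 l) := by
  refine ((hasDerivAt_iff_tendsto_slope.1 hb).comp tendsto_qpar).congr fun τ ↦ ?_
  simp [slope_def_field, hb0]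

lemma eventually_im_pos : ∀ᶠ τ : ℂ in comap im atTop, 0 < τ.im :=
  tendsto_comap.eventually (eventually_gt_atTop 0)

/-- The cube of the weight two form in terms of eta quotients. -/
lemma cubicP_pow_three {τ : ℂ} (hτ : 0 < τ.im) :
    cubicP τ ^ 3 / etaProd τ = etaQuot τ + 54 + 729 / etaQuot τ := by
  rw [← sub_eq_zero]
  refine eq_zero_of_fricke_invariant
    (F := fun τ ↦ cubicP τ ^ 3 / etaProd τ - (etaQuot τ + 54 + 729 / etaQuot τ)) ?_ ?_ ?_ ?_ hτ
  · exact ((differentiableOn_cubicP.pow 3).div differentiableOn_etaProd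
      fun _ hz ↦ etaProd_ne_zero hz).sub ((differentiableOn_etaQuot.add_const _).add
        ((differentiableOn_const _).div differentiableOn_etaQuot fun _ hz ↦ etaQuot_ne_zero hz))
  · intro z hz
    simp only [cubicP_add_one hz, etaProd_add_one, etaQuot_add_one]
  · intro z hz
    have h0 := ne_zero_of_im_pos hz
    have h1 := etaProd_ne_zero hz
    have h2 := etaQuot_ne_zero hz
    simp only [cubicP_fricke hz, etaProd_fricke hz, etaQuot_fricke hz]
    field_simp
    ring
  · set b : ℂ → ℂ := fun q ↦ cubicPDisc q ^ 3 / etaProdDisc q -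
      (etaQuotDisc q + 54 * q + 729 * q ^ 2 / etaQuotDisc q) with hb
    have hb0 : b 0 = 0 := by
      simp [b, cubicPDisc_zero, etaProdDisc_zero, etaQuotDisc_zero]
    have hb1 : HasDerivAt b 0 0 := by
      have h := ((hasDerivAt_cubicPDisc_zero.pow 3).div hasDerivAt_etaProdDisc_zero
        (etaProdDisc_ne_zero (by simp))).sub
        ((hasDerivAt_etaQuotDisc_zero.add ((hasDerivAt_id (0 : ℂ)).const_mul 54)).add
        ((((hasDerivAt_id (0 : ℂ)).pow 2).const_mul 729).div hasDerivAt_etaQuotDisc_zero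
          (etaQuotDisc_ne_zero (by simp))))
      norm_num [cubicPDisc_zero, etaProdDisc_zero, etaQuotDisc_zero] at h
      exact h
    refine (tendsto_comp_qpar_div hb1 hb0).congr' ?_
    filter_upwards [eventually_im_pos] with τ hτ
    have h0 := qpar_ne_zero τ
    have hq := norm_qpar_lt_one hτ
    have h1 := etaProdDisc_ne_zero hq
    have h2 := etaQuotDisc_ne_zero hq
    simp only [b, cubicP_eq hτ, etaProd_eq, etaQuot_eq]
    field_simp

lemma mem_nhds_upperHalfPlane {τ : ℂ} (hτ : 0 < τ.im) : {z : ℂ | 0 < z.im} ∈ 𝓝 τ :=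
  isOpen_upperHalfPlane.mem_nhds hτ

lemma differentiableOn_deriv_cubicP : DifferentiableOn ℂ (deriv cubicP) {z | 0 < z.im} :=
  differentiableOn_cubicP.deriv isOpen_upperHalfPlane

lemma differentiableOn_deriv_deriv_cubicP :
    DifferentiableOn ℂ (deriv (deriv cubicP)) {z | 0 < z.im} :=
  differentiableOn_deriv_cubicP.deriv isOpen_upperHalfPlane

lemma hasDerivAt_cubicP {τ : ℂ} (hτ : 0 < τ.im) : HasDerivAt cubicP (deriv cubicP τ) τ :=
  (differentiableOn_cubicP.differentiableAt (mem_nhds_upperHalfPlane hτ)).hasDerivAt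

lemma hasDerivAt_deriv_cubicP {τ : ℂ} (hτ : 0 < τ.im) :
    HasDerivAt (deriv cubicP) (deriv (deriv cubicP) τ) τ :=
  (differentiableOn_deriv_cubicP.differentiableAt (mem_nhds_upperHalfPlane hτ)).hasDerivAt

lemma deriv_add_one_of_periodic {f : ℂ → ℂ} (hf : ∀ τ : ℂ, 0 < τ.im → f (τ + 1) = f τ) {τ : ℂ}
    (hτ : 0 < τ.im) : deriv f (τ + 1) = deriv f τ := by
  rw [← deriv_comp_add_const]
  exact EventuallyEq.deriv_eq (eventually_of_mem (mem_nhds_upperHalfPlane hτ) hf)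

lemma deriv_fricke {f g : ℂ → ℂ} {g' τ : ℂ} (hf : DifferentiableOn ℂ f {z | 0 < z.im})
    (hfg : ∀ τ : ℂ, 0 < τ.im → f (-1 / (3 * τ)) = g τ) (hτ : 0 < τ.im)
    (hg : HasDerivAt g g' τ) : deriv f (-1 / (3 * τ)) = 3 * τ ^ 2 * g' := by
  have h0 := ne_zero_of_im_pos hτ
  have h1 : HasDerivAt (fun τ : ℂ ↦ -1 / (3 * τ)) (1 / (3 * τ ^ 2)) τ := by
    refine ((hasDerivAt_const τ (-1 : ℂ)).div ((hasDerivAt_id τ).const_mul 3)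
      (mul_ne_zero three_ne_zero h0)).congr_deriv ?_
    simp only [id]
    field_simp
    norm_num
  have h2 := (hf.differentiableAt (mem_nhds_upperHalfPlane (im_fricke_pos hτ))).hasDerivAt.comp τ h1
  have h3 : HasDerivAt (f ∘ fun τ : ℂ ↦ -1 / (3 * τ)) g' τ :=
    hg.congr_of_eventuallyEq (eventually_of_mem (mem_nhds_upperHalfPlane hτ) hfg)
  rw [← h2.unique h3]
  field_simp

lemma deriv_cubicP_fricke {τ : ℂ} (hτ : 0 < τ.im) :
    deriv cubicP (-1 / (3 * τ)) = -18 * τ ^ 3 * cubicP τ - 9 * τ ^ 4 * deriv cubicP τ := by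
  rw [deriv_fricke differentiableOn_cubicP (g := fun τ ↦ -3 * τ ^ 2 * cubicP τ)
    (fun z hz ↦ cubicP_fricke hz) hτ
    ((((hasDerivAt_id τ).pow 2).const_mul (-3)).mul (hasDerivAt_cubicP hτ))]
  simp only [Pi.pow_apply, id]
  push_cast
  ring

lemma deriv_deriv_cubicP_fricke {τ : ℂ} (hτ : 0 < τ.im) :
    deriv (deriv cubicP) (-1 / (3 * τ)) = -162 * τ ^ 4 * cubicP τ - 162 * τ ^ 5 * deriv cubicP τ -
      27 * τ ^ 6 * deriv (deriv cubicP) τ := by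
  rw [deriv_fricke differentiableOn_deriv_cubicP
    (g := fun τ ↦ -18 * τ ^ 3 * cubicP τ - 9 * τ ^ 4 * deriv cubicP τ)
    (fun z hz ↦ deriv_cubicP_fricke hz) hτ
    (((((hasDerivAt_id τ).pow 3).const_mul (-18)).mul (hasDerivAt_cubicP hτ)).sub
      ((((hasDerivAt_id τ).pow 4).const_mul 9).mul (hasDerivAt_deriv_cubicP hτ)))]
  simp only [Pi.pow_apply, id]
  push_cast
  ring

/-- The defect in the second order differential equation satisfied by `cubicP`. -/
def cubicDefect (τ : ℂ) : ℂ :=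
  2 * cubicP τ * deriv (deriv cubicP) τ - 3 * deriv cubicP τ ^ 2 -
    24 * (2 * Real.pi * I) ^ 2 * (cubicP τ * etaProd τ)

lemma cubicDefect_add_one {τ : ℂ} (hτ : 0 < τ.im) : cubicDefect (τ + 1) = cubicDefect τ := by
  have h1 (z : ℂ) (hz : 0 < z.im) : deriv cubicP (z + 1) = deriv cubicP z :=
    deriv_add_one_of_periodic (fun z hz ↦ cubicP_add_one hz) hz
  simp only [cubicDefect, cubicP_add_one hτ, etaProd_add_one, h1 τ hτ,
    deriv_add_one_of_periodic h1 hτ]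

lemma cubicDefect_fricke {τ : ℂ} (hτ : 0 < τ.im) :
    cubicDefect (-1 / (3 * τ)) = 81 * τ ^ 8 * cubicDefect τ := by
  simp only [cubicDefect, cubicP_fricke hτ, etaProd_fricke hτ, deriv_cubicP_fricke hτ,
    deriv_deriv_cubicP_fricke hτ]
  ring

lemma hasDerivAt_comp_qpar {f : ℂ → ℂ} (hf : DifferentiableOn ℂ f (Metric.ball 0 1)) {τ : ℂ}
    (hτ : 0 < τ.im) : HasDerivAt (fun τ ↦ f (qpar τ))
      (2 * Real.pi * I * (qpar τ * deriv f (qpar τ))) τ := by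
  have h1 := (hf.differentiableAt (Metric.isOpen_ball.mem_nhds (mapsTo_qpar hτ))).hasDerivAt
  exact (h1.comp τ (hasDerivAt_qpar τ)).congr_deriv (by ring)

lemma deriv_cubicP_eq {τ : ℂ} (hτ : 0 < τ.im) :
    deriv cubicP τ = 2 * Real.pi * I * (qpar τ * deriv cubicPDisc (qpar τ)) :=
  ((hasDerivAt_comp_qpar differentiableOn_cubicPDisc hτ).congr_of_eventuallyEq
    (eventually_of_mem (mem_nhds_upperHalfPlane hτ) fun _ hz ↦ cubicP_eq hz)).deriv

lemma differentiableOn_deriv_cubicPDisc :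
    DifferentiableOn ℂ (deriv cubicPDisc) (Metric.ball 0 1) :=
  differentiableOn_cubicPDisc.deriv Metric.isOpen_ball

lemma deriv_deriv_cubicP_eq {τ : ℂ} (hτ : 0 < τ.im) :
    deriv (deriv cubicP) τ = (2 * Real.pi * I) ^ 2 *
      (qpar τ * (deriv cubicPDisc (qpar τ) + qpar τ * deriv (deriv cubicPDisc) (qpar τ))) := by
  have h1 := ((hasDerivAt_qpar τ).mul
    (hasDerivAt_comp_qpar differentiableOn_deriv_cubicPDisc hτ)).const_mul (2 * Real.pi * I)
  refine ((h1.congr_of_eventuallyEq (eventually_of_mem (mem_nhds_upperHalfPlane hτ)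
    fun _ hz ↦ deriv_cubicP_eq hz)).congr_deriv ?_).deriv
  ring

/-- The second order differential equation satisfied by `cubicP`. -/
lemma cubicDefect_eq_zero {τ : ℂ} (hτ : 0 < τ.im) : cubicDefect τ = 0 := by
  suffices cubicDefect τ ^ 3 / etaProd τ ^ 4 = 0 by
    simpa [etaProd_ne_zero hτ] using this
  refine eq_zero_of_fricke_invariant (F := fun τ ↦ cubicDefect τ ^ 3 / etaProd τ ^ 4) ?_ ?_ ?_ ?_ hτ
  · refine DifferentiableOn.div (DifferentiableOn.pow ?_ 3) (differentiableOn_etaProd.pow 4)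
      fun _ hz ↦ pow_ne_zero 4 (etaProd_ne_zero hz)
    exact (((differentiableOn_cubicP.const_mul 2).mul differentiableOn_deriv_deriv_cubicP).sub
      ((differentiableOn_deriv_cubicP.pow 2).const_mul 3)).sub
      ((differentiableOn_cubicP.mul differentiableOn_etaProd).const_mul _)
  · intro z hz
    simp only [cubicDefect_add_one hz, etaProd_add_one]
  · intro z hz
    have h0 := ne_zero_of_im_pos hz
    have h1 := etaProd_ne_zero hz
    simp only [cubicDefect_fricke hz, etaProd_fricke hz]
    field_simp
    ring
  · set B : ℂ → ℂ := fun q ↦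
      2 * cubicPDisc q * (deriv cubicPDisc q + q * deriv (deriv cubicPDisc) q) -
        3 * (q * deriv cubicPDisc q ^ 2) - 24 * (cubicPDisc q * etaProdDisc q) with hB
    have hd2 : DifferentiableOn ℂ (deriv (deriv cubicPDisc)) (Metric.ball 0 1) :=
      differentiableOn_deriv_cubicPDisc.deriv Metric.isOpen_ball
    have hBd : DifferentiableOn ℂ B (Metric.ball 0 1) :=
      (((differentiableOn_cubicPDisc.const_mul 2).mul (differentiableOn_deriv_cubicPDisc.add
        (differentiableOn_id.mul hd2))).sub
        ((differentiableOn_id.mul (differentiableOn_deriv_cubicPDisc.pow 2)).const_mul 3)).sub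
        ((differentiableOn_cubicPDisc.mul differentiableOn_etaProdDisc).const_mul 24)
    have hB0 : B 0 = 0 := by
      simp [B, cubicPDisc_zero, etaProdDisc_zero, hasDerivAt_cubicPDisc_zero.deriv]
      norm_num
    have hB1 := (hBd.differentiableAt
      (Metric.isOpen_ball.mem_nhds zero_mem_unitBall)).hasDerivAt
    set b : ℂ → ℂ := fun q ↦ ((2 * Real.pi * I) ^ 2) ^ 3 * (B q ^ 3 / etaProdDisc q ^ 4)
    have hb1 : HasDerivAt b 0 0 := by
      refine (((hB1.pow 3).div (hasDerivAt_etaProdDisc_zero.pow 4)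
        (pow_ne_zero 4 (etaProdDisc_ne_zero (by simp)))).const_mul
        (((2 * Real.pi * I) ^ 2) ^ 3)).congr_deriv ?_
      simp [hB0]
    refine (tendsto_comp_qpar_div hb1 (by simp [b, hB0])).congr' ?_
    filter_upwards [eventually_im_pos] with τ hτ
    have h0 := qpar_ne_zero τ
    have h1 := etaProdDisc_ne_zero (norm_qpar_lt_one hτ)
    have h2 : cubicDefect τ = (2 * Real.pi * I) ^ 2 * qpar τ * B (qpar τ) := by
      simp only [cubicDefect, cubicP_eq hτ, etaProd_eq, deriv_cubicP_eq hτ,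
        deriv_deriv_cubicP_eq hτ, B]
      ring
    simp only [b, h2, etaProd_eq]
    field_simp

/-- A power series converging on the unit disc is holomorphic there, and its Euler derivative is
computed termwise. -/
lemma differentiableOn_and_hasSum_mul_deriv_of_hasSum {f : ℂ → ℂ} {a : ℕ → ℂ}
    (hf : ∀ z ∈ Metric.ball (0 : ℂ) 1, HasSum (fun n ↦ a n * z ^ n) (f z)) :
    DifferentiableOn ℂ f (Metric.ball 0 1) ∧
      ∀ z ∈ Metric.ball (0 : ℂ) 1, HasSum (fun n ↦ n * a n * z ^ n) (z * deriv f z) := by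
  have key (z : ℂ) (hz : z ∈ Metric.ball (0 : ℂ) 1) :
      DifferentiableAt ℂ f z ∧ HasSum (fun n ↦ n * a n * z ^ n) (z * deriv f z) := by
    obtain ⟨r, hzr, hr1⟩ := exists_between (mem_ball_zero_iff.1 hz)
    have hr0 : 0 ≤ r := (norm_nonneg z).trans hzr.le
    have hu : Summable fun n ↦ ‖a n‖ * r ^ n := by
      have := (hf (r : ℂ) (by simpa [abs_of_nonneg hr0] using hr1)).summable.norm
      simpa [abs_of_nonneg hr0] using this
    have hF (n : ℕ) : DifferentiableOn ℂ (fun w : ℂ ↦ a n * w ^ n) (Metric.ball 0 r) := by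
      fun_prop
    have hle (n : ℕ) (w : ℂ) (hw : w ∈ Metric.ball (0 : ℂ) r) :
        ‖a n * w ^ n‖ ≤ ‖a n‖ * r ^ n := by
      rw [norm_mul, norm_pow]
      have := (mem_ball_zero_iff.1 hw).le
      gcongr
    have hzr' : z ∈ Metric.ball (0 : ℂ) r := mem_ball_zero_iff.2 hzr
    have hnhds := Metric.isOpen_ball.mem_nhds hzr'
    have heq : f =ᶠ[𝓝 z] fun w ↦ ∑' n, a n * w ^ n := by
      filter_upwards [hnhds] with w hw
      exact (hf w (Metric.ball_subset_ball hr1.le hw)).tsum_eq.symm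
    refine ⟨((differentiableOn_tsum_of_summable_norm hu hF Metric.isOpen_ball hle).differentiableAt
      hnhds).congr_of_eventuallyEq heq, ?_⟩
    rw [heq.deriv_eq]
    refine ((hasSum_deriv_of_summable_norm hu hF Metric.isOpen_ball hle hzr').mul_left z).congr_fun
      fun n ↦ ?_
    rw [((hasDerivAt_pow n z).const_mul (a n)).deriv]
    rcases n with _ | n
    · simp
    · rw [Nat.add_sub_cancel, pow_succ]
      ring
  exact ⟨fun z hz ↦ (key z hz).1.differentiableWithinAt, fun z hz ↦ (key z hz).2⟩

/-- The coefficients of the Gauss hypergeometric series. -/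
def hypCoeff (a b c : ℂ) (n : ℕ) : ℂ :=
  ((ascPochhammer ℂ n).eval a * (ascPochhammer ℂ n).eval b) /
    ((ascPochhammer ℂ n).eval c * (n.factorial : ℂ))

lemma hasSum_hyp2F1 {a b c z : ℂ}
    (habc : ∀ n : ℕ, (n : ℂ) ≠ -a ∧ (n : ℂ) ≠ -b ∧ (n : ℂ) ≠ -c) (hz : z ∈ Metric.ball (0 : ℂ) 1) :
    HasSum (fun n ↦ hypCoeff a b c n * z ^ n) (hyp2F1 a b c z) := by
  refine Summable.hasSum ?_
  have hrad := ordinaryHypergeometricSeries_radius_eq_one ℂ a b c habc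
  have := (ordinaryHypergeometricSeries ℂ a b c).summable (x := z) (by
    rw [hrad, ← ENNReal.ofReal_one, Metric.eball_ofReal]; exact hz)
  refine this.congr fun n ↦ ?_
  rw [ordinaryHypergeometricSeries_apply_eq, smul_eq_mul, hypCoeff]
  ring

lemma hypCoeff_succ {a b c : ℂ} (hc : ∀ n : ℕ, (n : ℂ) ≠ -c) (n : ℕ) :
    ((n : ℂ) + 1) * (c + n) * hypCoeff a b c (n + 1) = (a + n) * (b + n) * hypCoeff a b c n := by
  have h1 : (n : ℂ) + 1 ≠ 0 := Nat.cast_add_one_ne_zero n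
  have h2 : c + n ≠ 0 := fun h ↦ hc n (by linear_combination h)
  by_cases h3 : (ascPochhammer ℂ n).eval c = 0
  · simp [hypCoeff, ascPochhammer_succ_eval, h3]
  have h4 : (n.factorial : ℂ) ≠ 0 := Nat.cast_ne_zero.2 n.factorial_ne_zero
  simp only [hypCoeff, ascPochhammer_succ_eval, Nat.factorial_succ]
  push_cast
  field_simp

lemma hyp2F1_zero {a b c : ℂ} : hyp2F1 a b c 0 = 1 := by
  rw [hyp2F1, tsum_eq_single 0 fun n hn ↦ by simp [hn]]
  simp

/-- The hypergeometric function `₂F₁(1/6, 2/3; 1; z)`. -/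
def hypH (z : ℂ) : ℂ := hyp2F1 (1 / 6) (2 / 3) 1 z

/-- The Euler derivative of `hypH`. -/
def eulerHypH (z : ℂ) : ℂ := z * deriv hypH z

lemma natCast_ne_neg {x : ℂ} (hx : 0 < x.re) (n : ℕ) : (n : ℂ) ≠ -x := fun h ↦ by
  have := congrArg re h
  rw [natCast_re, neg_re] at this
  linarith [n.cast_nonneg (α := ℝ)]

lemma hasSum_hypH {z : ℂ} (hz : z ∈ Metric.ball (0 : ℂ) 1) :
    HasSum (fun n ↦ hypCoeff (1 / 6) (2 / 3) 1 n * z ^ n) (hypH z) :=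
  hasSum_hyp2F1 (fun n ↦ ⟨natCast_ne_neg (by norm_num) n, natCast_ne_neg (by norm_num) n,
    natCast_ne_neg (by norm_num) n⟩) hz

lemma differentiableOn_hypH : DifferentiableOn ℂ hypH (Metric.ball 0 1) :=
  (differentiableOn_and_hasSum_mul_deriv_of_hasSum fun _ hz ↦ hasSum_hypH hz).1

lemma hasSum_eulerHypH {z : ℂ} (hz : z ∈ Metric.ball (0 : ℂ) 1) :
    HasSum (fun n ↦ n * hypCoeff (1 / 6) (2 / 3) 1 n * z ^ n) (eulerHypH z) :=
  (differentiableOn_and_hasSum_mul_deriv_of_hasSum fun _ hz ↦ hasSum_hypH hz).2 z hz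

lemma differentiableOn_eulerHypH : DifferentiableOn ℂ eulerHypH (Metric.ball 0 1) :=
  (differentiableOn_and_hasSum_mul_deriv_of_hasSum fun _ hz ↦ hasSum_eulerHypH hz).1

/-- The hypergeometric differential equation. -/
lemma mul_deriv_eulerHypH {z : ℂ} (hz : z ∈ Metric.ball (0 : ℂ) 1) :
    z * deriv eulerHypH z =
      z * (z * deriv eulerHypH z + 5 / 6 * eulerHypH z + 1 / 9 * hypH z) := by
  have h2 := (differentiableOn_and_hasSum_mul_deriv_of_hasSum fun _ hz ↦ hasSum_eulerHypH hz).2 z hz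
  refine h2.unique ?_
  have h := ((h2.add ((hasSum_eulerHypH hz).mul_left (5 / 6))).add
    ((hasSum_hypH hz).mul_left (1 / 9))).mul_left z
  rw [← hasSum_nat_add_iff' 1]
  simp only [Finset.range_one, Finset.sum_singleton, Nat.cast_zero, zero_mul, sub_zero]
  refine h.congr_fun fun n ↦ ?_
  have := hypCoeff_succ (a := 1 / 6) (b := 2 / 3) (c := 1) (natCast_ne_neg (by norm_num)) n
  push_cast
  linear_combination z ^ (n + 1) * this

lemma hypH_zero : hypH 0 = 1 := hyp2F1_zero

lemma eulerHypH_zero : eulerHypH 0 = 0 := zero_mul _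

/-- The hauptmodul `-27 η(3τ)¹² / η(τ)¹²`. -/
def hauptS (τ : ℂ) : ℂ := -27 * dedekindEta (3 * τ) ^ 12 / dedekindEta τ ^ 12

lemma etaQuot_mul_hauptS {τ : ℂ} (hτ : 0 < τ.im) : etaQuot τ * hauptS τ = -27 := by
  have h1 := dedekindEta_ne_zero hτ
  have h2 := dedekindEta_ne_zero (im_three_mul_pos hτ)
  rw [etaQuot, hauptS]
  field_simp

lemma hauptS_ne_zero {τ : ℂ} (hτ : 0 < τ.im) : hauptS τ ≠ 0 := fun h ↦ by
  simpa [h] using etaQuot_mul_hauptS hτ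

lemma cubicP_pow_three_mul_hauptS {τ : ℂ} (hτ : 0 < τ.im) :
    cubicP τ ^ 3 * hauptS τ = -27 * (1 - hauptS τ) ^ 2 * etaProd τ := by
  have h := cubicP_pow_three hτ
  have h1 := etaProd_ne_zero hτ
  have h2 := hauptS_ne_zero hτ
  have h3 : etaQuot τ = -27 / hauptS τ := by rw [eq_div_iff h2, etaQuot_mul_hauptS hτ]
  rw [h3] at h
  field_simp at h
  linear_combination h / 27

lemma cubicP_ode {τ : ℂ} (hτ : 0 < τ.im) :
    9 * (1 - hauptS τ) ^ 2 * (2 * cubicP τ * deriv (deriv cubicP) τ - 3 * deriv cubicP τ ^ 2) =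
      -8 * (2 * Real.pi * I) ^ 2 * cubicP τ ^ 4 * hauptS τ := by
  have h := cubicDefect_eq_zero hτ
  rw [cubicDefect] at h
  linear_combination 9 * (1 - hauptS τ) ^ 2 * h +
    8 * (2 * Real.pi * I) ^ 2 * cubicP τ * cubicP_pow_three_mul_hauptS hτ

lemma logDeriv_dedekindEta {τ : ℂ} (hτ : 0 < τ.im) :
    logDeriv dedekindEta τ = Real.pi * I / 12 * Eis2 τ := by
  have := ModularForm.logDeriv_eta_eq_E2 ⟨τ, hτ⟩
  rwa [E2_eq_Eis2, ← dedekindEta_eq_eta] at this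

lemma hasDerivAt_dedekindEta {τ : ℂ} (hτ : 0 < τ.im) :
    HasDerivAt dedekindEta (Real.pi * I / 12 * Eis2 τ * dedekindEta τ) τ := by
  refine (differentiableAt_dedekindEta hτ).hasDerivAt.congr_deriv ?_
  rw [← logDeriv_dedekindEta hτ, logDeriv_apply, div_mul_cancel₀ _ (dedekindEta_ne_zero hτ)]

lemma hasDerivAt_hauptS {τ : ℂ} (hτ : 0 < τ.im) :
    HasDerivAt hauptS (2 * Real.pi * I * cubicP τ * hauptS τ) τ := by
  have h1 := dedekindEta_ne_zero hτ
  have h3 : HasDerivAt (fun z ↦ dedekindEta (3 * z))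
      (Real.pi * I / 12 * Eis2 (3 * τ) * dedekindEta (3 * τ) * (3 * 1)) τ :=
    (hasDerivAt_dedekindEta (im_three_mul_pos hτ)).comp τ ((hasDerivAt_id τ).const_mul 3)
  refine (((h3.pow 12).const_mul (-27)).div ((hasDerivAt_dedekindEta hτ).pow 12)
    (pow_ne_zero 12 h1)).congr_deriv ?_
  simp only [hauptS, cubicP, Pi.pow_apply]
  field_simp
  push_cast
  ring

lemma tendsto_comp_qpar {f : ℂ → ℂ} (hf : DifferentiableOn ℂ f (Metric.ball 0 1)) :
    Tendsto (fun τ ↦ f (qpar τ)) (comap im atTop) (𝓝 (f 0)) :=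
  (hf.differentiableAt (Metric.isOpen_ball.mem_nhds zero_mem_unitBall)).continuousAt.tendsto.comp
    (tendsto_qpar.mono_right nhdsWithin_le_nhds)

lemma tendsto_cubicP : Tendsto cubicP (comap im atTop) (𝓝 1) := by
  have h := tendsto_comp_qpar differentiableOn_cubicPDisc
  rw [cubicPDisc_zero] at h
  exact h.congr' (eventually_im_pos.mono fun _ hτ ↦ (cubicP_eq hτ).symm)

lemma tendsto_deriv_cubicP : Tendsto (deriv cubicP) (comap im atTop) (𝓝 0) := by
  have h := (tendsto_comp_qpar (differentiableOn_id.mul differentiableOn_deriv_cubicPDisc)).const_mul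
    (2 * Real.pi * I)
  simp only [Pi.mul_apply, id, zero_mul, mul_zero] at h
  exact h.congr' (eventually_im_pos.mono fun _ hτ ↦ (deriv_cubicP_eq hτ).symm)

lemma tendsto_hauptS : Tendsto hauptS (comap im atTop) (𝓝 0) := by
  have h := tendsto_comp_qpar ((differentiableOn_id.const_mul (-27)).div differentiableOn_etaQuotDisc
    fun q hq ↦ etaQuotDisc_ne_zero (mem_ball_zero_iff.1 hq))
  simp only [Pi.div_apply, id, mul_zero, zero_div] at h
  refine h.congr' (eventually_im_pos.mono fun τ hτ ↦ ?_)
  have h1 := etaQuot_mul_hauptS hτ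
  have h2 := qpar_ne_zero τ
  have h3 := etaQuotDisc_ne_zero (norm_qpar_lt_one hτ)
  rw [etaQuot_eq] at h1
  field_simp at h1 ⊢
  linear_combination -h1

instance comap_im_atTop_neBot : (comap im atTop).NeBot :=
  atTop_neBot.comap_of_surj fun x ↦ ⟨x * I, by simp⟩

/-- A function with zero derivative on a half-plane is equal to its limit at infinity. -/
lemma eq_of_deriv_eq_zero_of_tendsto {f : ℂ → ℂ} {l : ℂ} {Y : ℝ}
    (hf : ∀ τ : ℂ, Y < τ.im → HasDerivAt f 0 τ) (hl : Tendsto f (comap im atTop) (𝓝 l)) {τ : ℂ}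
    (hτ : Y < τ.im) : f τ = l := by
  have hopen : IsOpen {z : ℂ | Y < z.im} := isOpen_lt continuous_const continuous_im
  have hconst : ∀ z : ℂ, Y < z.im → f z = f τ := fun z hz ↦
    hopen.is_const_of_deriv_eq_zero (convex_halfSpace_im_gt Y).isPreconnected
      (fun w hw ↦ (hf w hw).differentiableAt.differentiableWithinAt)
      (fun w hw ↦ (hf w hw).deriv) hz hτ
  refine tendsto_nhds_unique (tendsto_const_nhds.congr' ?_) hl
  filter_upwards [tendsto_comap.eventually (eventually_gt_atTop Y)] with z hz
  exact (hconst z hz).symm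

/-- The base of the power in the hypergeometric solution. -/
def hypBase (s : ℂ) : ℂ := (1 - s) / (1 + s)

/-- The argument of the hypergeometric function. -/
def hypArg (s : ℂ) : ℂ := 4 * s / (1 + s) ^ 2

/-- The hypergeometric solution. -/
def hypSol (s : ℂ) : ℂ := hypBase s ^ ((1 : ℂ) / 3) * hypH (hypArg s)

/-- The Euler derivative of the hypergeometric solution. -/
def eulerHypSol (s : ℂ) : ℂ := hypBase s ^ ((1 : ℂ) / 3) *
  (-2 * s / (3 * (1 - s ^ 2)) * hypH (hypArg s) + hypBase s * eulerHypH (hypArg s))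

/-- The conditions under which the hypergeometric solution is holomorphic. -/
def IsGoodParam (s : ℂ) : Prop :=
  1 + s ≠ 0 ∧ 1 - s ≠ 0 ∧ hypBase s ∈ slitPlane ∧ hypArg s ∈ Metric.ball (0 : ℂ) 1

section

variable {s : ℂ → ℂ} {k τ : ℂ}

lemma hasDerivAt_hypBase (h : 1 + s τ ≠ 0) (h' : 1 - s τ ≠ 0) (hs : HasDerivAt s (k * s τ) τ) :
    HasDerivAt (fun τ ↦ hypBase (s τ))
      (hypBase (s τ) * (-2 * k * s τ / (1 - s τ ^ 2))) τ := by
  refine ((hs.const_sub 1).div (hs.const_add 1) h).congr_deriv ?_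
  rw [hypBase, show 1 - s τ ^ 2 = (1 - s τ) * (1 + s τ) by ring]
  field_simp
  ring

lemma hasDerivAt_hypBase_cpow (h : IsGoodParam (s τ)) (hs : HasDerivAt s (k * s τ) τ) :
    HasDerivAt (fun τ ↦ hypBase (s τ) ^ ((1 : ℂ) / 3))
      (hypBase (s τ) ^ ((1 : ℂ) / 3) * (-2 * k * s τ / (3 * (1 - s τ ^ 2)))) τ := by
  refine ((hasDerivAt_hypBase h.1 h.2.1 hs).cpow_const h.2.2.1).congr_deriv ?_
  have h0 := slitPlane_ne_zero h.2.2.1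
  rw [cpow_sub _ _ h0, cpow_one]
  field_simp

lemma hasDerivAt_hypArg (h : 1 + s τ ≠ 0) (hs : HasDerivAt s (k * s τ) τ) :
    HasDerivAt (fun τ ↦ hypArg (s τ)) (k * hypBase (s τ) * hypArg (s τ)) τ := by
  refine ((hs.const_mul 4).div ((hs.const_add 1).pow 2) (pow_ne_zero 2 h)).congr_deriv ?_
  simp only [hypBase, hypArg, Pi.pow_apply]
  push_cast
  field_simp
  ring

lemma hasDerivAt_comp_hypArg {f : ℂ → ℂ} (hf : DifferentiableOn ℂ f (Metric.ball 0 1))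
    (h : IsGoodParam (s τ)) (hs : HasDerivAt s (k * s τ) τ) :
    HasDerivAt (fun τ ↦ f (hypArg (s τ)))
      (k * hypBase (s τ) * (hypArg (s τ) * deriv f (hypArg (s τ)))) τ := by
  have h1 := (hf.differentiableAt (Metric.isOpen_ball.mem_nhds h.2.2.2)).hasDerivAt
  exact (h1.comp τ (hasDerivAt_hypArg h.1 hs)).congr_deriv (by ring)

lemma hasDerivAt_hypSol (h : IsGoodParam (s τ)) (hs : HasDerivAt s (k * s τ) τ) :
    HasDerivAt (fun τ ↦ hypSol (s τ)) (k * eulerHypSol (s τ)) τ := by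
  refine ((hasDerivAt_hypBase_cpow h hs).mul
    (hasDerivAt_comp_hypArg differentiableOn_hypH h hs)).congr_deriv ?_
  rw [eulerHypSol, ← eulerHypH]
  ring

lemma one_sub_sq_ne_zero {s : ℂ} (h : 1 + s ≠ 0) (h' : 1 - s ≠ 0) : 1 - s ^ 2 ≠ 0 := by
  rw [show 1 - s ^ 2 = (1 - s) * (1 + s) by ring]
  exact mul_ne_zero h' h

lemma hypBase_sq {s : ℂ} (h : 1 + s ≠ 0) : hypBase s ^ 2 = 1 - hypArg s := by
  rw [hypBase, hypArg]
  field_simp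
  ring

lemma hasDerivAt_eulerHypSol (h : IsGoodParam (s τ)) (hs : HasDerivAt s (k * s τ) τ) :
    HasDerivAt (fun τ ↦ eulerHypSol (s τ))
      (k * (-2 * s τ / (9 * (1 - s τ) ^ 2)) * hypSol (s τ)) τ := by
  obtain ⟨h1, h2, h3, h4⟩ := id h
  have h5 := one_sub_sq_ne_zero h1 h2
  have hα := (hs.const_mul (-2)).div (((hs.pow 2).const_sub 1).const_mul 3)
    (mul_ne_zero three_ne_zero h5)
  refine ((hasDerivAt_hypBase_cpow h hs).mul ((hα.mul
    (hasDerivAt_comp_hypArg differentiableOn_hypH h hs)).add ((hasDerivAt_hypBase h1 h2 hs).mul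
    (hasDerivAt_comp_hypArg differentiableOn_eulerHypH h hs)))).congr_deriv ?_
  have hode : hypBase (s τ) ^ 2 * (hypArg (s τ) * deriv eulerHypH (hypArg (s τ))) =
      hypArg (s τ) * (5 / 6 * eulerHypH (hypArg (s τ)) + 1 / 9 * hypH (hypArg (s τ))) := by
    rw [hypBase_sq h1]
    linear_combination mul_deriv_eulerHypH h4
  rw [← eulerHypH, hypSol]
  simp only [Pi.pow_apply, Pi.mul_apply, Pi.div_apply, Pi.add_apply]
  generalize hypBase (s τ) ^ ((1 : ℂ) / 3) = m
  generalize hypArg (s τ) * deriv eulerHypH (hypArg (s τ)) = H2 at *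
  generalize eulerHypH (hypArg (s τ)) = H1 at *
  generalize hypH (hypArg (s τ)) = H0 at *
  generalize s τ = x at *
  have hmain : -2 * x / (3 * (1 - x ^ 2)) * (-2 * x / (3 * (1 - x ^ 2)) * H0 + hypBase x * H1) +
      (-2 * x * (3 * (1 - x ^ 2)) + 2 * x * (3 * (-2 * x ^ 2))) / (3 * (1 - x ^ 2)) ^ 2 * H0 +
      -2 * x / (3 * (1 - x ^ 2)) * hypBase x * H1 +
      hypBase x * (-2 * x / (1 - x ^ 2)) * H1 +
      hypArg x * (5 / 6 * H1 + 1 / 9 * H0) = -2 * x / (9 * (1 - x) ^ 2) * H0 := by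
    rw [hypBase, hypArg, show 1 - x ^ 2 = (1 - x) * (1 + x) by ring]
    field_simp
    ring
  push_cast
  linear_combination k * m * hode + k * m * hmain

end

lemma hypBase_zero : hypBase 0 = 1 := by simp [hypBase]

lemma hypArg_zero : hypArg 0 = 0 := by simp [hypArg]

lemma continuousAt_hypBase : ContinuousAt hypBase 0 := by
  unfold hypBase
  fun_prop (disch := simp)

lemma continuousAt_hypArg : ContinuousAt hypArg 0 := by
  unfold hypArg
  fun_prop (disch := simp)

lemma continuousAt_comp_hypArg {f : ℂ → ℂ} (hf : DifferentiableOn ℂ f (Metric.ball 0 1)) :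
    ContinuousAt (fun s ↦ f (hypArg s)) 0 :=
  ContinuousAt.comp (by
    rw [hypArg_zero]
    exact (hf.differentiableAt (Metric.isOpen_ball.mem_nhds zero_mem_unitBall)).continuousAt)
    continuousAt_hypArg

lemma continuousAt_hypBase_cpow : ContinuousAt (fun s ↦ hypBase s ^ ((1 : ℂ) / 3)) 0 :=
  continuousAt_hypBase.cpow continuousAt_const (by simp [hypBase_zero])

lemma continuousAt_hypSol : ContinuousAt hypSol 0 :=
  continuousAt_hypBase_cpow.mul (continuousAt_comp_hypArg differentiableOn_hypH)

lemma continuousAt_eulerHypSol : ContinuousAt eulerHypSol 0 := by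
  refine continuousAt_hypBase_cpow.mul (ContinuousAt.add (ContinuousAt.mul ?_
    (continuousAt_comp_hypArg differentiableOn_hypH))
    (continuousAt_hypBase.mul (continuousAt_comp_hypArg differentiableOn_eulerHypH)))
  fun_prop (disch := simp)

lemma hypSol_zero : hypSol 0 = 1 := by simp [hypSol, hypBase_zero, hypArg_zero, hypH_zero]

lemma eulerHypSol_zero : eulerHypSol 0 = 0 := by simp [eulerHypSol, hypArg_zero, eulerHypH_zero]

lemma eventually_isGoodParam : ∀ᶠ s in 𝓝 (0 : ℂ), IsGoodParam s := by
  have h1 : ∀ᶠ s : ℂ in 𝓝 0, 1 + s ≠ 0 :=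
    ContinuousAt.eventually_ne (by fun_prop) (by simp)
  have h2 : ∀ᶠ s : ℂ in 𝓝 0, 1 - s ≠ 0 :=
    ContinuousAt.eventually_ne (by fun_prop) (by simp)
  have h3 : ∀ᶠ s : ℂ in 𝓝 0, hypBase s ∈ slitPlane :=
    continuousAt_hypBase.eventually_mem (isOpen_slitPlane.mem_nhds (by simp [hypBase_zero]))
  have h4 : ∀ᶠ s : ℂ in 𝓝 0, hypArg s ∈ Metric.ball (0 : ℂ) 1 :=
    continuousAt_hypArg.eventually_mem (Metric.isOpen_ball.mem_nhds (by simp [hypArg_zero]))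
  filter_upwards [h1, h2, h3, h4] with s h1 h2 h3 h4 using ⟨h1, h2, h3, h4⟩

lemma exists_forall_isGoodParam : ∃ Y : ℝ, 0 < Y ∧ ∀ τ : ℂ, Y < τ.im →
    IsGoodParam (hauptS τ) ∧ cubicP τ ≠ 0 := by
  obtain ⟨Y, hY⟩ := eventually_atTop.1 <| eventually_comap.1 <|
    (tendsto_hauptS.eventually eventually_isGoodParam).and
      (tendsto_cubicP.eventually_ne one_ne_zero)
  exact ⟨max Y 1, by positivity, fun τ hτ ↦
    hY τ.im ((le_max_left _ _).trans hτ.le) τ rfl⟩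

/-- The quantity measuring the failure of `hypSol ∘ hauptS` to be a square root of `cubicP`. -/
def wronskian (τ : ℂ) : ℂ :=
  hypSol (hauptS τ) * deriv cubicP τ -
    2 * (2 * Real.pi * I) * cubicP τ ^ 2 * eulerHypSol (hauptS τ)

lemma hasDerivAt_wronskian_sq {τ : ℂ} (hτ : 0 < τ.im) (hs : IsGoodParam (hauptS τ))
    (hP : cubicP τ ≠ 0) : HasDerivAt (fun τ ↦ wronskian τ ^ 2 / cubicP τ ^ 3) 0 τ := by
  have hV := hasDerivAt_hypSol hs (hasDerivAt_hauptS hτ)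
  have hW := hasDerivAt_eulerHypSol hs (hasDerivAt_hauptS hτ)
  have hP' := hasDerivAt_cubicP hτ
  have hP'' := hasDerivAt_deriv_cubicP hτ
  have hX := (hV.mul hP'').sub (((hP'.pow 2).const_mul (2 * (2 * Real.pi * I))).mul hW)
  refine ((HasDerivAt.pow (f := wronskian) hX 2).div (hP'.pow 3)
    (pow_ne_zero 3 hP)).congr_deriv ?_
  have hode := cubicP_ode hτ
  have h1 := hs.2.1
  simp only [wronskian, Pi.pow_apply]
  rw [div_eq_zero_iff]
  left
  generalize hypSol (hauptS τ) = V at *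
  generalize eulerHypSol (hauptS τ) = W at *
  generalize deriv (deriv cubicP) τ = P2 at *
  generalize deriv cubicP τ = P1 at *
  generalize (2 * Real.pi * I : ℂ) = c at *
  generalize hauptS τ = s at *
  generalize cubicP τ = P at *
  have hode' : 2 * P * P2 - 3 * P1 ^ 2 = 4 * c ^ 2 * P ^ 4 * (-2 * s / (9 * (1 - s) ^ 2)) := by
    field_simp
    linear_combination hode
  push_cast
  linear_combination (V * P1 - 2 * c * P ^ 2 * W) * V * P ^ 2 * hode'

lemma tendsto_hypSol_hauptS :
    Tendsto (fun τ ↦ hypSol (hauptS τ)) (comap im atTop) (𝓝 1) := by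
  simpa [hypSol_zero, comp_def] using continuousAt_hypSol.tendsto.comp tendsto_hauptS

lemma tendsto_eulerHypSol_hauptS :
    Tendsto (fun τ ↦ eulerHypSol (hauptS τ)) (comap im atTop) (𝓝 0) := by
  simpa [eulerHypSol_zero, comp_def] using continuousAt_eulerHypSol.tendsto.comp tendsto_hauptS

lemma cubicP_eq_hypSol_sq : ∃ Y : ℝ, 0 < Y ∧ ∀ τ : ℂ, Y < τ.im →
    cubicP τ = hypSol (hauptS τ) ^ 2 := by
  obtain ⟨Y, hY0, hY⟩ := exists_forall_isGoodParam
  have hwlim : Tendsto (fun τ ↦ wronskian τ ^ 2 / cubicP τ ^ 3) (comap im atTop) (𝓝 0) := by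
    have := (((tendsto_hypSol_hauptS.mul tendsto_deriv_cubicP).sub
      (((tendsto_cubicP.pow 2).const_mul (2 * (2 * Real.pi * I))).mul
        tendsto_eulerHypSol_hauptS)).pow 2).div (tendsto_cubicP.pow 3) (by simp)
    simpa [wronskian, Pi.div_def] using this
  have hw (τ : ℂ) (hτ : Y < τ.im) : wronskian τ = 0 := by
    have := eq_of_deriv_eq_zero_of_tendsto (fun τ hτ ↦ hasDerivAt_wronskian_sq (hY0.trans hτ)
      (hY τ hτ).1 (hY τ hτ).2) hwlim hτ
    simpa [(hY τ hτ).2] using this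
  have hlim : Tendsto (fun τ ↦ hypSol (hauptS τ) ^ 2 / cubicP τ) (comap im atTop) (𝓝 1) := by
    simpa [Pi.div_def] using (tendsto_hypSol_hauptS.pow 2).div tendsto_cubicP one_ne_zero
  refine ⟨Y, hY0, fun τ hτ ↦ ?_⟩
  have := eq_of_deriv_eq_zero_of_tendsto (Y := Y) (fun τ hτ ↦ ?_) hlim hτ
  · exact ((div_eq_one_iff_eq (hY τ hτ).2).1 this).symm
  · have h0 := hY0.trans hτ
    obtain ⟨hs, hP⟩ := hY τ hτ
    refine (((hasDerivAt_hypSol hs (hasDerivAt_hauptS h0)).pow 2).div (hasDerivAt_cubicP h0)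
      hP).congr_deriv ?_
    have := hw τ hτ
    rw [wronskian] at this
    simp only [Pi.pow_apply]
    rw [div_eq_zero_iff]
    left
    push_cast
    linear_combination -hypSol (hauptS τ) * this

lemma hypSol_sq (s : ℂ) : hypSol s ^ 2 =
    ((1 - s) / (1 + s)) ^ ((2 : ℂ) / 3) * hyp2F1 (1 / 6) (2 / 3) 1 (4 * s / (1 + s) ^ 2) ^ 2 := by
  rw [hypSol, mul_pow, ← cpow_nat_mul, hypH, hypBase, hypArg]
  norm_num

end

/- STATEMENT 17: with `s = −27 η(3τ)¹²/η(τ)¹²`,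
`(3E₂(3τ) − E₂(τ))/2 = ((1−s)/(1+s))^{2/3} ₂F₁(1/6,2/3;1;4s/(1+s)²)²`
for `Im τ` large. -/

theorem stmt17 :
    ∃ Y : ℝ, 0 < Y ∧ ∀ τ : ℂ, Y < τ.im →
      (3 * Eis2 (3 * τ) - Eis2 τ) / 2
        = ((1 - (-27 * dedekindEta (3 * τ) ^ 12 / dedekindEta τ ^ 12)) /
            (1 + (-27 * dedekindEta (3 * τ) ^ 12 / dedekindEta τ ^ 12))) ^ ((2 : ℂ) / 3) *
          (hyp2F1 (1/6) (2/3) 1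
            (4 * (-27 * dedekindEta (3 * τ) ^ 12 / dedekindEta τ ^ 12) /
              (1 + (-27 * dedekindEta (3 * τ) ^ 12 / dedekindEta τ ^ 12)) ^ 2)) ^ 2 := by
  obtain ⟨Y, hY0, hY⟩ := cubicP_eq_hypSol_sq
  exact ⟨Y, hY0, fun τ hτ ↦ (hY τ hτ).trans (hypSol_sq _)⟩
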